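/- For 1≤n≤7, A(n)=0; A(8)=A(9)=1; A(n)=2 for 10≤n≤13. For n≥14, let m be the unique integer with 2t_{m-1} ≤ n < 2t_m (necessarily m≥4), and set α_m=2t_{m-1}, β_m=t_m+2t_{m-3}−1, γ_m=2t_m−t_{m-1}, θ_m=(3t_m+t_{m-2}−3)/2. Then: A(n)=n−(t_m+t_{m-3}+m+3)/2 if α_m ≤ n < β_m; A(n)=(t_{m-1}+t_{m-2}+4t_{m-3}−m−5)/2 if β_m ≤ n < γ_m; A(n)=n−(t_{m-1}+3t_{m-2}+m+3)/2 if γ_m ≤ n < θ_m; and A(n)=(2t_{m-1}+t_{m-2}+3t_{m-3}−m−6)/2 if θ_m ≤ n < 2t_m. -/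

import Mathlib

/-- The three-letter alphabet of the Tribonacci word. -/
inductive TLetter : Type
  | a | b | c
deriving DecidableEq

/-- The Tribonacci substitution σ(a)=ab, σ(b)=ac, σ(c)=a. -/
def tsubst : TLetter → List TLetter
  | .a => [.a, .b]
  | .b => [.a, .c]
  | .c => [.a]

/-- `Tword m = σ^m(a)`, the m-th finite Tribonacci word. -/
def Tword : ℕ → List TLetter
  | 0 => [.a]
  | n + 1 => (Tword n).flatMap tsubst

/-- The prefix 𝕋[1,n] of the Tribonacci word of length n
(each `Tword n` is a prefix of the next and has length ≥ n). -/
def TPrefix (n : ℕ) : List TLetter := (Tword n).take n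

/-- A word is a factor of the Tribonacci word 𝕋. -/
def IsFactorT (w : List TLetter) : Prop := ∃ m, w <:+: Tword m

/-- `tribAux i = t_{i-2}`: Tribonacci numbers, shifted so that the index is a natural. -/
def tribAux : ℕ → ℕ
  | 0 => 0
  | 1 => 1
  | 2 => 1
  | n + 3 => tribAux (n + 2) + tribAux (n + 1) + tribAux n

/-- The Tribonacci numbers `t m` for `m : ℤ`: t₋₂=0, t₋₁=1, t₀=1,
`t m = t (m-1) + t (m-2) + t (m-3)` for m ≥ 1. (Junk value 0 below -2.) -/
def t (m : ℤ) : ℕ := tribAux (m + 2).toNat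

/-- Kernel numbers: k₀=0, k₁=k₂=1, `k m = k (m-1) + k (m-2) + k (m-3) - 1` for m ≥ 3. -/
def kAux : ℕ → ℕ
  | 0 => 0
  | 1 => 1
  | 2 => 1
  | n + 3 => kAux (n + 2) + kAux (n + 1) + kAux n - 1

def kker (m : ℤ) : ℕ := kAux m.toNat

/-- `A n`: the number of distinct nonempty words w with ww a factor of 𝕋[1,n]. -/
noncomputable def A (n : ℕ) : ℕ := Nat.card {w : List TLetter // w ≠ [] ∧ (w ++ w) <:+: TPrefix n}

/-- `B n`: the number of occurrences of squares in 𝕋[1,n], i.e. of pairs (w,i) with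
w nonempty, i ≥ 1, ww occurring in 𝕋 at position i and i + 2|w| - 1 ≤ n. -/
noncomputable def B (n : ℕ) : ℕ :=
  Nat.card {p : List TLetter × ℕ // p.1 ≠ [] ∧ 1 ≤ p.2 ∧
    p.2 + 2 * p.1.length - 1 ≤ n ∧ (p.1 ++ p.1) <+: (TPrefix n).drop (p.2 - 1)}

/-- `C n`: the number of distinct nonempty words w with www a factor of 𝕋[1,n]. -/
noncomputable def C (n : ℕ) : ℕ := Nat.card {w : List TLetter // w ≠ [] ∧ (w ++ w ++ w) <:+: TPrefix n}

/-- `D n`: the number of occurrences of cubes in 𝕋[1,n], i.e. of pairs (w,i) with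
w nonempty, i ≥ 1, www occurring in 𝕋 at position i and i + 3|w| - 1 ≤ n. -/
noncomputable def D (n : ℕ) : ℕ :=
  Nat.card {p : List TLetter × ℕ // p.1 ≠ [] ∧ 1 ≤ p.2 ∧
    p.2 + 3 * p.1.length - 1 ≤ n ∧ (p.1 ++ p.1 ++ p.1) <+: (TPrefix n).drop (p.2 - 1)}

namespace Tribonacci

/-- The infinite Tribonacci word, indexed from `0`. -/
def letter (i : ℕ) : TLetter := (Tword i).getD i .a

/-- The prefix of length `n` of the infinite Tribonacci word. -/
def pre (n : ℕ) : List TLetter := (List.range n).map letter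

/-- The length of `σ^k(x)`. -/
def len : ℕ → TLetter → ℕ
  | 0, _ => 1
  | k + 1, .a => len k .a + len k .b
  | k + 1, .b => len k .a + len k .c
  | k + 1, .c => len k .a

/-- The length of the image under `σ^k` of the prefix of length `i`. -/
def pos (k i : ℕ) : ℕ := ∑ j ∈ Finset.range i, len k (letter j)

/-- The length of the `k`-th bispecial (palindromic) prefix of the Tribonacci word. -/
def palLen : ℕ → ℕ
  | 0 => 0
  | k + 1 => palLen k + len k .a

/-- The factor of length `p` starting at position `s`. -/
def word (s p : ℕ) : List TLetter := (List.range p).map fun j => letter (s + j)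

lemma length_flatMap_tsubst (l : List TLetter) :
    (l.flatMap tsubst).length = (l.map (len 1)).sum := by
  induction l with
  | nil => rfl
  | cons x l ih =>
    rw [List.flatMap_cons, List.length_append, ih, List.map_cons, List.sum_cons]
    cases x <;> rfl

lemma len_pos (k : ℕ) (x : TLetter) : 0 < len k x := by
  induction k generalizing x with
  | zero => simp [len]
  | succ k ih => cases x <;> simp [len, ih]

lemma Tword_prefix_succ (k : ℕ) : Tword k <+: Tword (k + 1) := by
  induction k with
  | zero => exact ⟨[.b], rfl⟩
  | succ k ih =>
    obtain ⟨r, hr⟩ := ih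
    refine ⟨r.flatMap tsubst, ?_⟩
    conv_rhs => rw [Tword, ← hr, List.flatMap_append]
    rfl

lemma Tword_prefix {k l : ℕ} (h : k ≤ l) : Tword k <+: Tword l := by
  induction l, h using Nat.le_induction with
  | base => exact List.prefix_refl _
  | succ l _ ih => exact ih.trans (Tword_prefix_succ l)

lemma length_le_length_flatMap_tsubst (l : List TLetter) :
    l.length ≤ (l.flatMap tsubst).length := by
  induction l with
  | nil => rfl
  | cons x l ih =>
    rw [List.flatMap_cons, List.length_append, List.length_cons]
    have : 0 < (tsubst x).length := by cases x <;> simp [tsubst]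
    omega

lemma lt_length_Tword (k : ℕ) : k < (Tword k).length := by
  induction k with
  | zero => simp [Tword]
  | succ k ih =>
    obtain ⟨r, hr⟩ := Tword_prefix (Nat.zero_le k)
    have h := length_le_length_flatMap_tsubst r
    rw [Tword, ← hr, List.flatMap_append, List.length_append]
    rw [← hr, List.length_append] at ih
    simp only [Tword, List.flatMap_singleton, tsubst, List.length_cons,
      List.length_nil] at ih ⊢
    omega

lemma getElem_Tword {k i : ℕ} (h : i < (Tword k).length) : (Tword k)[i] = letter i := by
  have hi := lt_length_Tword i
  rw [letter, List.getD_eq_getElem _ _ hi]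
  rcases le_total k i with hki | hki
  · exact (Tword_prefix hki).getElem h
  · exact ((Tword_prefix hki).getElem hi).symm

lemma take_Tword {k n : ℕ} (h : n ≤ (Tword k).length) : (Tword k).take n = pre n := by
  apply List.ext_getElem
  · simp [pre, h]
  · intro i h₁ h₂
    simp [pre, getElem_Tword]

lemma TPrefix_eq (n : ℕ) : TPrefix n = pre n := take_Tword (lt_length_Tword n).le

lemma eq_pre_of_prefix {l : List TLetter} {k : ℕ} (h : l <+: Tword k) : l = pre l.length := by
  rw [← take_Tword h.length_le, ← List.prefix_iff_eq_take]
  exact h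

lemma pos_succ (k i : ℕ) : pos k (i + 1) = pos k i + len k (letter i) :=
  Finset.sum_range_succ _ _

lemma pos_zero (k : ℕ) : pos k 0 = 0 := rfl

lemma pos_mono (k : ℕ) : StrictMono (pos k) :=
  strictMono_nat_of_lt_succ fun i => by rw [pos_succ]; have := len_pos k (letter i); omega

lemma pre_succ (n : ℕ) : pre (n + 1) = pre n ++ [letter n] := by
  simp [pre, List.range_succ]

lemma flatMap_pre (i : ℕ) : (pre i).flatMap tsubst = pre (pos 1 i) := by
  have hp : (pre i).flatMap tsubst <+: Tword (i + 1) := by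
    rw [← take_Tword (lt_length_Tword i).le]
    conv_rhs => rw [Tword, ← List.take_append_drop i (Tword i), List.flatMap_append]
    exact List.prefix_append _ _
  have hl : ((pre i).flatMap tsubst).length = pos 1 i := by
    rw [length_flatMap_tsubst, pos, pre, List.map_map, ← Finset.sum_map_val, Finset.range_val,
      Multiset.range, Multiset.map_coe, Multiset.sum_coe]
    rfl
  rw [eq_pre_of_prefix hp, hl]

lemma pre_append_tsubst (i : ℕ) :
    pre (pos 1 (i + 1)) = pre (pos 1 i) ++ tsubst (letter i) := by
  rw [← flatMap_pre, pre_succ, List.flatMap_append, flatMap_pre]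
  simp

lemma letter_pos_add {i j : ℕ} (h : j < (tsubst (letter i)).length) :
    letter (pos 1 i + j) = (tsubst (letter i))[j] := by
  have h₀ := pre_append_tsubst i
  have h₁ : (pre (pos 1 i)).length = pos 1 i := by simp [pre]
  have h₂ : pos 1 i + j < (pre (pos 1 (i + 1))).length := by
    rw [h₀, List.length_append]
    omega
  have h₃ : (pre (pos 1 (i + 1)))[pos 1 i + j] = letter (pos 1 i + j) := by simp [pre]
  rw [← h₃]
  simp only [h₀]
  rw [List.getElem_append_right (by omega)]
  simp [h₁]

lemma letter_pos (i : ℕ) : letter (pos 1 i) = .a := by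
  have h := letter_pos_add (i := i) (j := 0) (by cases letter i <;> simp [tsubst])
  rw [add_zero] at h
  rw [h]
  generalize letter i = x
  cases x <;> rfl

lemma letter_pos_succ_of_a {i : ℕ} (h : letter i = .a) : letter (pos 1 i + 1) = .b := by
  have h := letter_pos_add (i := i) (j := 1) (by rw [h]; simp [tsubst])
  simp_all [tsubst]

lemma letter_pos_succ_of_b {i : ℕ} (h : letter i = .b) : letter (pos 1 i + 1) = .c := by
  have h := letter_pos_add (i := i) (j := 1) (by rw [h]; simp [tsubst])
  simp_all [tsubst]

lemma letter_pos_succ_of_c {i : ℕ} (h : letter i = .c) : letter (pos 1 i + 1) = .a := by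
  rw [← letter_pos (i + 1), pos_succ, h]
  rfl

lemma letter_eq_of_pos_succ {i j : ℕ} (h : letter (pos 1 i + 1) = letter (pos 1 j + 1)) :
    letter i = letter j := by
  rcases hi : letter i with _ | _ | _ <;> rcases hj : letter j with _ | _ | _ <;>
    simp_all [letter_pos_succ_of_a, letter_pos_succ_of_b, letter_pos_succ_of_c]

lemma exists_block (x : ℕ) : ∃ i, x = pos 1 i ∨ (x = pos 1 i + 1 ∧ pos 1 (i + 1) = x + 1) := by
  induction x with
  | zero => exact ⟨0, Or.inl rfl⟩
  | succ x ih =>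
    obtain ⟨i, h | ⟨_, h⟩⟩ := ih
    · rcases hi : letter i with _ | _ | _
      · exact ⟨i, Or.inr ⟨by omega, by rw [pos_succ, hi, ← h]; rfl⟩⟩
      · exact ⟨i, Or.inr ⟨by omega, by rw [pos_succ, hi, ← h]; rfl⟩⟩
      · exact ⟨i + 1, Or.inl (by rw [pos_succ, hi, ← h]; rfl)⟩
    · exact ⟨i + 1, Or.inl h.symm⟩

lemma exists_pos_of_letter_eq_a {x : ℕ} (h : letter x = .a) : ∃ i, x = pos 1 i := by
  obtain ⟨i, hi | ⟨hx, hi⟩⟩ := exists_block x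
  · exact ⟨i, hi⟩
  · rcases hl : letter i with _ | _ | _
    · rw [hx, letter_pos_succ_of_a hl] at h; simp at h
    · rw [hx, letter_pos_succ_of_b hl] at h; simp at h
    · rw [pos_succ, hl] at hi
      simp [len] at hi
      omega

lemma letter_pred_of_ne_a {x : ℕ} (h : letter x ≠ .a) : 0 < x ∧ letter (x - 1) = .a := by
  obtain ⟨i, hi | ⟨hx, -⟩⟩ := exists_block x
  · exact absurd (hi ▸ letter_pos i) h
  · subst hx
    exact ⟨by omega, by simpa using letter_pos i⟩

lemma pos_pos_one (k i : ℕ) : pos k (pos 1 i) = pos (k + 1) i := by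
  induction i with
  | zero => rfl
  | succ i ih =>
    rw [pos_succ 1, pos_succ (k + 1), ← ih]
    rcases hl : letter i with _ | _ | _
    · simp [len, pos_succ, ← add_assoc, letter_pos, letter_pos_succ_of_a hl]
    · simp [len, pos_succ, ← add_assoc, letter_pos, letter_pos_succ_of_b hl]
    · simp [len, pos_succ, letter_pos]

lemma pos_zero_left (i : ℕ) : pos 0 i = i := by simp [pos, len]

lemma pos_one_pos (k i : ℕ) : pos 1 (pos k i) = pos (k + 1) i := by
  induction k generalizing i with
  | zero => rw [pos_zero_left]
  | succ k ih => rw [← pos_pos_one k i, ih, pos_pos_one]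

lemma pos_palLen (j k : ℕ) : pos j (palLen k) + palLen j = palLen (j + k) := by
  induction k generalizing j with
  | zero => simp [palLen, pos_zero]
  | succ k ih =>
    have h₁ : palLen (k + 1) = pos 1 (palLen k) + 1 := by
      have := ih 1
      rw [add_comm 1 k] at this
      simpa [palLen, len] using this.symm
    have h₂ := ih (j + 1)
    rw [h₁, pos_succ, letter_pos, pos_pos_one, ← add_assoc j k 1, add_right_comm j k 1, ← h₂, palLen]
    omega

lemma palLen_succ (k : ℕ) : palLen (k + 1) = pos 1 (palLen k) + 1 := by
  have := pos_palLen 1 k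
  rw [add_comm 1 k] at this
  simpa [palLen, len] using this.symm

/-- Two equal factors have images of equal length and their images agree,
including the letter that follows. -/
lemma pos_one_add {i l L : ℕ} (h : ∀ j < L, letter (i + j) = letter (l + j)) {j : ℕ}
    (hj : j ≤ L) : pos 1 (i + j) + pos 1 l = pos 1 (l + j) + pos 1 i := by
  induction j with
  | zero => simp [add_comm]
  | succ j ih =>
    have := ih (by omega)
    rw [← add_assoc, ← add_assoc, pos_succ, pos_succ, h j (by omega)]
    omega

lemma letter_pos_palLen (k i : ℕ) {j : ℕ} (hj : j < palLen k) :
    letter (pos k i + j) = letter j := by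
  induction k generalizing j with
  | zero => simp [palLen] at hj
  | succ k ih =>
    have h₀ : ∀ j < palLen k, letter (pos k i + j) = letter (0 + j) := fun j hj => by
      rw [ih hj, zero_add]
    have h₁ := fun {j} => pos_one_add h₀ (j := j)
    simp only [pos_one_pos, pos_zero, zero_add, add_zero] at h₁
    rw [palLen_succ] at hj
    obtain ⟨l, hl | ⟨hl, hl'⟩⟩ := exists_block j
    · have hlp : l ≤ palLen k := (pos_mono 1).le_iff_le.1 (by omega)
      rw [hl, letter_pos, add_comm (pos (k + 1) i), ← h₁ hlp, letter_pos]
    · have hlp : l < palLen k := (pos_mono 1).lt_iff_lt.1 (by omega)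
      have e : pos (k + 1) i + j = pos 1 (pos k i + l) + 1 := by
        rw [h₁ hlp.le]; omega
      rw [e, hl]
      have := ih hlp
      rcases hx : letter l with _ | _ | _
      · rw [letter_pos_succ_of_a hx, letter_pos_succ_of_a (this.trans hx)]
      · rw [letter_pos_succ_of_b hx, letter_pos_succ_of_b (this.trans hx)]
      · rw [letter_pos_succ_of_c hx, letter_pos_succ_of_c (this.trans hx)]

lemma lt_pos_one {i : ℕ} (hi : 0 < i) : i < pos 1 i := by
  induction i, hi using Nat.le_induction with
  | base => decide
  | succ i _ ih =>
    rw [pos_succ]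
    have := len_pos 1 (letter i)
    omega

/-- Every pair of equal factors at distinct positions extends to a pair of occurrences of a
bispecial prefix, coming from two distinct letters under a power of the substitution. -/
lemma exists_desubstitution (J : ℕ) : ∀ i L : ℕ, i < J →
    (∀ j < L, letter (i + j) = letter (J + j)) →
    ∃ k x y, x < y ∧ letter x ≠ letter y ∧ pos k x ≤ i ∧ i + L ≤ pos k x + palLen k ∧
      J + pos k x = i + pos k y := by
  induction J using Nat.strong_induction_on with
  | _ J IH =>
    have main : ∀ i L : ℕ, i < J → 0 < L → (∀ j < L, letter (i + j) = letter (J + j)) →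
        ∃ k x y, x < y ∧ letter x ≠ letter y ∧ pos k x ≤ i ∧ i + L ≤ pos k x + palLen k ∧
          J + pos k x = i + pos k y := by
      intro i L hiJ hL h
      have h0 : letter i = letter J := h 0 hL
      by_cases hia : letter i = .a
      · obtain ⟨I, rfl⟩ := exists_pos_of_letter_eq_a hia
        obtain ⟨J', rfl⟩ := exists_pos_of_letter_eq_a (h0 ▸ hia)
        have hIJ : I < J' := (pos_mono 1).lt_iff_lt.1 hiJ
        have hlt : J' < pos 1 J' := lt_pos_one (by omega)
        have hex : ∃ L', pos 1 I + L ≤ pos 1 (I + L') + 1 :=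
          ⟨pos 1 I + L, (by have := (pos_mono 1).le_apply (x := I + (pos 1 I + L)); omega)⟩
        classical
        have hmin := @Nat.find_min _ _ hex
        have hspec := Nat.find_spec hex
        set L' := Nat.find hex
        have hmatch : ∀ M ≤ L', ∀ j < M, letter (I + j) = letter (J' + j) := by
          intro M
          induction M with
          | zero => intro _ j hj; omega
          | succ M ih =>
            intro hM j hj
            have ih' := ih (by omega)
            rcases Nat.lt_succ_iff_lt_or_eq.1 hj with hj | rfl
            · exact ih' j hj
            · have hp := pos_one_add ih' le_rfl
              have hm := hmin (m := j) (by omega)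
              have hge : pos 1 I ≤ pos 1 (I + j) := (pos_mono 1).monotone (by omega)
              have := h (pos 1 (I + j) + 1 - pos 1 I) (by omega)
              apply letter_eq_of_pos_succ
              convert this using 2 <;> omega
        obtain ⟨k, x, y, hxy, hne, h₁, h₂, h₃⟩ := IH J' hlt I L' hIJ (hmatch L' le_rfl)
        have hpal : ∀ j < palLen k, letter (pos k x + j) = letter (0 + j) := fun j hj => by
          rw [letter_pos_palLen k x hj, zero_add]
        have hp := pos_one_add hpal le_rfl
        rw [pos_zero, zero_add, pos_one_pos, add_zero] at hp
        refine ⟨k + 1, x, y, hxy, hne, ?_, ?_, ?_⟩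
        · rw [← pos_one_pos]
          exact (pos_mono 1).monotone h₁
        · have := (pos_mono 1).monotone h₂
          rw [palLen_succ]
          omega
        · obtain ⟨d, rfl⟩ := Nat.exists_eq_add_of_le h₁
          obtain rfl : J' = pos k y + d := by omega
          have hd : ∀ j < d, letter (pos k x + j) = letter (pos k y + j) := by
            intro j hj
            rw [letter_pos_palLen k x (by omega), letter_pos_palLen k y (by omega)]
          have := pos_one_add hd le_rfl
          rw [pos_one_pos, pos_one_pos] at this
          omega
      · obtain ⟨hi, hi'⟩ := letter_pred_of_ne_a hia
        obtain ⟨hJ, hJ'⟩ := letter_pred_of_ne_a (h0 ▸ hia)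
        obtain ⟨k, x, y, hxy, hne, h₁, h₂, h₃⟩ := IH (J - 1) (by omega) (i - 1) (L + 1) (by omega)
          (by
            intro j hj
            rcases Nat.eq_zero_or_pos j with rfl | hj0
            · simp [hi', hJ']
            · convert h (j - 1) (by omega) using 2 <;> omega)
        exact ⟨k, x, y, hxy, hne, by omega, by omega, by omega⟩
    intro i L hiJ h
    rcases Nat.eq_zero_or_pos L with rfl | hL
    · by_cases h0 : letter i = letter J
      · obtain ⟨k, x, y, hxy, hne, h₁, h₂, h₃⟩ := main i 1 hiJ one_pos
          (by intro j hj; obtain rfl : j = 0 := by omega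
              simpa using h0)
        exact ⟨k, x, y, hxy, hne, h₁, by omega, h₃⟩
      · exact ⟨0, i, J, hiJ, h0, by simp [pos_zero_left], by simp [pos_zero_left],
          by simp [pos_zero_left, add_comm]⟩
    · exact main i L hiJ hL h

lemma len_c_le_len_b (k : ℕ) : len k .c ≤ len k .b ∧ len k .b ≤ len k .a := by
  induction k with
  | zero => simp [len]
  | succ k ih => simp only [len]; omega

lemma len_c_le (k : ℕ) (x : TLetter) : len k .c ≤ len k x := by
  have := len_c_le_len_b k
  cases x <;> omega

/-- The length of the bispecial prefixes in terms of the lengths of the images of the letters. -/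
lemma two_mul_palLen (k : ℕ) : 2 * palLen k + 3 = len k .a + len k .b + len k .c := by
  induction k with
  | zero => rfl
  | succ k ih => simp only [len, palLen]; omega

lemma len_a_le_palLen_succ (k : ℕ) : len k .a ≤ palLen k + 1 := by
  have h : len k .a + 1 ≤ len k .b + len k .c ∧ len k .b + 1 ≤ len k .a + len k .c := by
    induction k with
    | zero => simp [len]
    | succ k ih =>
      have := len_c_le_len_b k
      have := len_pos k .a
      simp only [len]
      omega
  have := two_mul_palLen k
  omega

lemma palLen_lt (k : ℕ) : palLen k < len k .a + len k .c := by
  have := two_mul_palLen k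
  have := len_c_le_len_b k
  omega

lemma len_mono {k l : ℕ} (h : k ≤ l) (x : TLetter) : len k x ≤ len l x := by
  induction l, h using Nat.le_induction with
  | base => rfl
  | succ l _ ih =>
    have := len_c_le_len_b l
    cases x <;> simp only [len] <;> omega

lemma palLen_mono : Monotone palLen := monotone_nat_of_le_succ fun k => by simp [palLen]

lemma lt_of_palLen_lt {k l : ℕ} (h : palLen k < palLen l) : k < l := by
  by_contra! hlk
  have := palLen_mono hlk
  omega

/-- A repetition with period `p` whose root is long enough has the period of a single letter
under a power of the substitution. -/
lemma exists_of_square {i p : ℕ} (hp : 0 < p) (h : ∀ j < p, letter (i + j) = letter (i + p + j)) :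
    ∃ k x, letter x ≠ letter (x + 1) ∧ pos k x ≤ i ∧ i + p ≤ pos k x + palLen k ∧
      p = len k (letter x) := by
  obtain ⟨k, x, y, hxy, hne, h₁, h₂, h₃⟩ := exists_desubstitution (i + p) i p (by omega) h
  obtain rfl : y = x + 1 := by
    by_contra hy
    have hle : pos k (x + 1 + 1) ≤ pos k y := (pos_mono k).monotone (by omega)
    have hlt := palLen_lt k
    have hc₁ := len_c_le k (letter x)
    have hc₂ := len_c_le k (letter (x + 1))
    rw [pos_succ, pos_succ] at hle
    by_cases hx : letter (x + 1) = .a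
    · rw [hx] at hle
      omega
    · have := (letter_pred_of_ne_a hx).2
      rw [Nat.add_sub_cancel] at this
      rw [this] at hle
      omega
  rw [pos_succ] at h₃
  exact ⟨k, x, hne, h₁, h₂, by omega⟩

lemma letter_eq_of_bispecial {k x s j : ℕ} (h : s + j < palLen k) :
    letter (pos k x + s + j) = letter (s + j) := by
  rw [add_assoc, letter_pos_palLen k x h]

lemma word_pos_add {k x s p : ℕ} (h : s + p ≤ palLen k) : word (pos k x + s) p = word s p := by
  apply List.map_congr_left
  intro j hj
  rw [List.mem_range] at hj
  exact letter_eq_of_bispecial (by omega)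

lemma length_word (s p : ℕ) : (word s p).length = p := by simp [word]

lemma word_add (s p q : ℕ) : word s (p + q) = word s p ++ word (s + p) q := by
  simp [word, List.range_add, Function.comp_def, add_assoc]

lemma word_eq_word_iff {s s' p : ℕ} :
    word s p = word s' p ↔ ∀ j < p, letter (s + j) = letter (s' + j) := by
  simp [word, List.map_inj_left]

lemma infix_pre_iff {w : List TLetter} {n : ℕ} :
    w <:+: pre n ↔ ∃ i, i + w.length ≤ n ∧ w = word i w.length := by
  have hpre : ∀ m, pre m = word 0 m := fun m => by simp [pre, word]
  constructor
  · rintro ⟨u, v, h⟩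
    have hl := congrArg List.length h
    rw [hpre, length_word, List.length_append, List.length_append] at hl
    refine ⟨u.length, by omega, ?_⟩
    rw [hpre, ← hl, word_add, word_add] at h
    have h₁ := (List.append_inj h (by simp [length_word])).1
    simpa using (List.append_inj h₁ (by simp [length_word])).2
  · rintro ⟨i, hi, hw⟩
    refine ⟨word 0 i, word (i + w.length) (n - (i + w.length)), ?_⟩
    conv_lhs => rw [hw, length_word]
    obtain ⟨d, rfl⟩ := Nat.exists_eq_add_of_le hi
    rw [hpre, word_add, word_add]
    simp

/-- The squares in a prefix are exactly those contained in the repetitions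
generated by two consecutive distinct letters. -/
lemma square_infix_iff {w : List TLetter} {n : ℕ} :
    (w ≠ [] ∧ w ++ w <:+: TPrefix n) ↔
      ∃ k x s, letter x ≠ letter (x + 1) ∧ s + len k (letter x) ≤ palLen k ∧
        pos k x + s + 2 * len k (letter x) ≤ n ∧ w = word s (len k (letter x)) := by
  rw [TPrefix_eq, infix_pre_iff]
  constructor
  · rintro ⟨hw, i, hi, h⟩
    have hp : 0 < w.length := List.length_pos_iff.2 hw
    rw [List.length_append] at hi
    rw [List.length_append, word_add] at h
    obtain ⟨h₁, h₂⟩ := List.append_inj h (by simp [length_word])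
    obtain ⟨k, x, hne, hx, hx', hl⟩ := exists_of_square hp (word_eq_word_iff.1 (h₁.symm.trans h₂))
    obtain ⟨s, rfl⟩ := Nat.exists_eq_add_of_le hx
    refine ⟨k, x, s, hne, by omega, by omega, ?_⟩
    rw [← hl, ← word_pos_add (k := k) (x := x) (by omega)]
    exact h₁
  · rintro ⟨k, x, s, -, hs, hn, rfl⟩
    refine ⟨fun h => ?_, pos k x + s, ?_, ?_⟩
    · have := congrArg List.length h
      have := len_pos k (letter x)
      simp [length_word] at *
      omega
    · simp only [List.length_append, length_word]
      omega
    · simp only [List.length_append, length_word]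
      rw [word_add, word_pos_add hs, add_right_comm, ← pos_succ, word_pos_add hs]

/-- The conjugates of a long enough word starting in the image of the first letter are distinct. -/
lemma word_injOn {k q s s' : ℕ} (hq : ∀ l, q ≤ palLen l → k ≤ l) (hs' : s < s')
    (hs : s < len k .a) (hd : s' < s + len k .a) : word s q ≠ word s' q := by
  intro h
  rw [word_eq_word_iff] at h
  obtain ⟨l, x, y, hxy, hne, h₁, h₂, h₃⟩ := exists_desubstitution s' s q hs' h
  have hkl := len_mono (hq l (by omega)) .a
  have hy : pos l (x + 1) ≤ pos l y := (pos_mono l).monotone hxy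
  rw [pos_succ] at hy
  have hx : x ≠ 0 := by
    rintro rfl
    have h0 : letter 0 = .a := rfl
    rw [h0] at hy
    omega
  have h1 : pos l 1 ≤ pos l x := (pos_mono l).monotone (by omega)
  have h1' : pos l 1 = len l .a := by simp [pos_succ, pos_zero]; rfl
  omega

lemma le_of_len_a_le_palLen {k l : ℕ} (h : len k .a ≤ palLen l) : k ≤ l := by
  rcases k with _ | k
  · exact Nat.zero_le _
  · refine lt_of_palLen_lt (lt_of_lt_of_le ?_ h)
    have := palLen_lt k
    have := len_c_le k .b
    simp only [len]
    omega

lemma le_of_len_b_le_palLen {k l : ℕ} (h : len k .b ≤ palLen l) : k ≤ l := by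
  rcases k with _ | k
  · exact Nat.zero_le _
  · exact lt_of_palLen_lt (lt_of_lt_of_le (palLen_lt k) h)

lemma lt_len_a (k : ℕ) : k < len k .a := by
  induction k with
  | zero => simp [len]
  | succ k ih =>
    have := len_pos k .b
    simp only [len]
    omega

lemma len_a_strictMono : StrictMono fun k => len k .a :=
  strictMono_nat_of_lt_succ fun k => by
    have := len_pos k .b
    simp only [len]
    omega

lemma len_b_strictMono : StrictMono fun k => len k .b :=
  strictMono_nat_of_lt_succ fun k => by
    have := len_pos k .c
    have := len_c_le_len_b k
    simp only [len]
    omega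

lemma len_a_ne_len_b {k l : ℕ} (h : len l .b ≤ palLen l) : len k .a ≠ len l .b := by
  intro hkl
  rcases l with _ | _ | l
  · simp [len, palLen] at h
  · simp [len, palLen] at h
  · have hlt : l + 1 < k := by
      apply len_a_strictMono.lt_iff_lt.1
      have := len_pos (l + 1) .c
      simp only [len] at *
      omega
    have := len_mono hlt .a
    have := len_pos l .c
    simp only [len] at *
    omega

/-- Offsets of the distinct squares of period `len k a` occurring in the prefix of length `n`. -/
def aSet (n k : ℕ) : Finset ℕ :=
  (Finset.range (len k .a)).filter fun s =>
    (s + len k .a ≤ palLen k ∧ s + 2 * len k .a ≤ n) ∨ pos (k + 1) 3 + s + 2 * len k .a ≤ n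

/-- Offsets of the distinct squares of period `len k b` occurring in the prefix of length `n`. -/
def bSet (n k : ℕ) : Finset ℕ :=
  (Finset.range (palLen k + 1 - len k .b)).filter fun s => len k .a + s + 2 * len k .b ≤ n

lemma pos_one_right (k : ℕ) : pos k 1 = len k .a := by
  rw [pos_succ, pos_zero, zero_add]
  rfl

lemma pos_three (k : ℕ) : pos k 3 = 2 * len k .a + len k .b := by
  have h₁ : letter 1 = .b := rfl
  have h₂ : letter 2 = .a := rfl
  rw [pos_succ, pos_succ, pos_one_right, h₁, h₂]
  omega

lemma square_infix_iff_mem {w : List TLetter} {n : ℕ} :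
    (w ≠ [] ∧ w ++ w <:+: TPrefix n) ↔
      (∃ k, ∃ s ∈ aSet n k, word s (len k .a) = w) ∨
        ∃ k, ∃ s ∈ bSet n k, word s (len k .b) = w := by
  rw [square_infix_iff]
  simp only [aSet, bSet, Finset.mem_filter, Finset.mem_range]
  constructor
  · rintro ⟨k, x, s, -, hs, hn, rfl⟩
    have hlt := palLen_lt k
    have hc := len_c_le k .a
    rcases hx : letter x with _ | _ | _
    · rw [hx] at hs hn
      exact Or.inl ⟨k, s, ⟨by omega, Or.inl ⟨hs, by omega⟩⟩, rfl⟩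
    · rw [hx] at hs hn
      have hx0 : x ≠ 0 := by rintro rfl; exact absurd hx (by decide)
      have := (pos_mono k).monotone (show 1 ≤ x by omega)
      rw [pos_one_right] at this
      exact Or.inr ⟨k, s, ⟨by omega, by omega⟩, rfl⟩
    · rw [hx] at hs hn
      rcases k with _ | k
      · simp [len, palLen] at hs
      have hx0 : x ≠ 0 := by rintro rfl; exact absurd hx (by decide)
      have hx1 : x ≠ 1 := by rintro rfl; exact absurd hx (by decide)
      have hx2 : x ≠ 2 := by rintro rfl; exact absurd hx (by decide)
      have := (pos_mono (k + 1)).monotone (show 3 ≤ x by omega)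
      have hk := palLen_lt k
      have hck := len_c_le k .a
      simp only [len, palLen] at hs hn ⊢
      by_cases hsk : s < len k .a
      · exact Or.inl ⟨k, s, ⟨hsk, Or.inr (by omega)⟩, rfl⟩
      · obtain ⟨s, rfl⟩ := Nat.exists_eq_add_of_le (not_lt.1 hsk)
        refine Or.inl ⟨k, s, ⟨by omega, Or.inr (by omega)⟩, ?_⟩
        rw [← pos_one_right, word_pos_add (by rw [pos_one_right]; omega)]
  · rintro (⟨k, s, ⟨hs, ⟨h₁, h₂⟩ | h⟩, rfl⟩ | ⟨k, s, ⟨hs, hn⟩, rfl⟩)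
    · exact ⟨k, 0, s, by decide, h₁, by rw [pos_zero]; exact (zero_add s).symm ▸ h₂, rfl⟩
    · refine ⟨k + 1, 3, s, by decide, ?_, h, rfl⟩
      have := len_a_le_palLen_succ k
      change s + len k .a ≤ palLen k + len k .a
      omega
    · refine ⟨k, 1, s, by decide, ?_, ?_, rfl⟩
      · change s + len k .b ≤ palLen k
        omega
      · rw [pos_one_right]
        exact hn

lemma A_eq_sum {n K : ℕ} (hK : n < K) :
    A n = ∑ k ∈ Finset.range K, (aSet n k).card + ∑ k ∈ Finset.range K, (bSet n k).card := by
  classical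
  set fa : (Σ _ : ℕ, ℕ) → List TLetter := fun p => word p.2 (len p.1 .a) with hfa
  set fb : (Σ _ : ℕ, ℕ) → List TLetter := fun p => word p.2 (len p.1 .b) with hfb
  set Sa := (Finset.range K).sigma (aSet n) with hSa
  set Sb := (Finset.range K).sigma (bSet n) with hSb
  have hset : ∀ w, (w ≠ [] ∧ w ++ w <:+: TPrefix n) ↔ w ∈ Sa.image fa ∪ Sb.image fb := by
    intro w
    rw [square_infix_iff_mem, Finset.mem_union, Finset.mem_image, Finset.mem_image]
    apply or_congr
    · constructor
      · rintro ⟨k, s, hs, rfl⟩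
        refine ⟨⟨k, s⟩, Finset.mem_sigma.2 ⟨Finset.mem_range.2 ?_, hs⟩, rfl⟩
        have := lt_len_a k
        simp only [aSet, Finset.mem_filter] at hs
        dsimp only
        omega
      · rintro ⟨⟨k, s⟩, hs, rfl⟩
        exact ⟨k, s, (Finset.mem_sigma.1 hs).2, rfl⟩
    · constructor
      · rintro ⟨k, s, hs, rfl⟩
        refine ⟨⟨k, s⟩, Finset.mem_sigma.2 ⟨Finset.mem_range.2 ?_, hs⟩, rfl⟩
        have := lt_len_a k
        simp only [bSet, Finset.mem_filter] at hs
        dsimp only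
        omega
      · rintro ⟨⟨k, s⟩, hs, rfl⟩
        exact ⟨k, s, (Finset.mem_sigma.1 hs).2, rfl⟩
  have hlen : ∀ {s s' p q : ℕ}, word s p = word s' q → p = q := fun {s s' p q} h => by
    simpa [length_word] using congrArg List.length h
  have hia : Set.InjOn fa Sa := by
    rintro ⟨k, s⟩ hs ⟨l, s'⟩ hs' h
    have hs₂ := (Finset.mem_sigma.1 hs).2
    have hs₂' := (Finset.mem_sigma.1 hs').2
    obtain rfl : k = l := len_a_strictMono.injective (hlen h)
    simp only [aSet, Finset.mem_filter, Finset.mem_range] at hs₂ hs₂'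
    rcases lt_trichotomy s s' with hlt | rfl | hlt
    · exact absurd h (word_injOn (k := k) (q := len k .a) (s := s) (s' := s')
        (fun _ => le_of_len_a_le_palLen) hlt (by omega) (by omega))
    · rfl
    · exact absurd h.symm (word_injOn (k := k) (q := len k .a) (s := s') (s' := s)
        (fun _ => le_of_len_a_le_palLen) hlt (by omega) (by omega))
  have hib : Set.InjOn fb Sb := by
    rintro ⟨k, s⟩ hs ⟨l, s'⟩ hs' h
    have hs₂ := (Finset.mem_sigma.1 hs).2
    have hs₂' := (Finset.mem_sigma.1 hs').2
    obtain rfl : k = l := len_b_strictMono.injective (hlen h)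
    simp only [bSet, Finset.mem_filter, Finset.mem_range] at hs₂ hs₂'
    have hk := palLen_lt k
    have hc := len_c_le k .b
    rcases lt_trichotomy s s' with hlt | rfl | hlt
    · exact absurd h (word_injOn (k := k) (q := len k .b) (s := s) (s' := s')
        (fun _ => le_of_len_b_le_palLen) hlt (by omega) (by omega))
    · rfl
    · exact absurd h.symm (word_injOn (k := k) (q := len k .b) (s := s') (s' := s)
        (fun _ => le_of_len_b_le_palLen) hlt (by omega) (by omega))
  have hdisj : Disjoint (Sa.image fa) (Sb.image fb) := by
    rw [Finset.disjoint_left]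
    intro w ha hb
    obtain ⟨⟨k, s⟩, -, rfl⟩ := Finset.mem_image.1 ha
    obtain ⟨⟨l, s'⟩, hs', h⟩ := Finset.mem_image.1 hb
    have hs₂ := (Finset.mem_sigma.1 hs').2
    simp only [bSet, Finset.mem_filter, Finset.mem_range] at hs₂
    exact len_a_ne_len_b (k := k) (l := l) (by omega) (hlen h).symm
  calc A n = Nat.card {w // w ∈ Sa.image fa ∪ Sb.image fb} :=
        Nat.card_congr (Equiv.subtypeEquivRight hset)
    _ = (Sa.image fa ∪ Sb.image fb).card := Nat.card_eq_card_toFinset _ |>.trans (by simp)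
    _ = _ := by
      rw [Finset.card_union_of_disjoint hdisj, Finset.card_image_of_injOn hia,
        Finset.card_image_of_injOn hib, Finset.card_sigma, Finset.card_sigma]

lemma card_aSet (n k : ℕ) :
    (aSet n k).card = min (palLen k + 1 - len k .a) (n + 1 - 2 * len k .a) +
      (min (len k .a) (n + 1 - (5 * len k .a + 2 * len k .b + len k .c)) -
        (palLen k + 1 - len k .a)) := by
  have h := palLen_lt k
  have hc := len_c_le k .a
  have hp : pos (k + 1) 3 = 3 * len k .a + 2 * len k .b + len k .c := by
    rw [pos_three]
    simp only [len]
    omega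
  have : aSet n k = Finset.range (min (palLen k + 1 - len k .a) (n + 1 - 2 * len k .a)) ∪
      Finset.Ico (palLen k + 1 - len k .a)
        (min (len k .a) (n + 1 - (5 * len k .a + 2 * len k .b + len k .c))) := by
    ext s
    simp only [aSet, hp, Finset.mem_filter, Finset.mem_range, Finset.mem_union, Finset.mem_Ico]
    omega
  rw [this, Finset.card_union_of_disjoint, Finset.card_range, Nat.card_Ico]
  rw [Finset.disjoint_left]
  intro s
  simp only [Finset.mem_range, Finset.mem_Ico]
  omega

lemma card_bSet (n k : ℕ) :
    (bSet n k).card =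
      min (palLen k + 1 - len k .b) (n + 1 - (len k .a + 2 * len k .b)) := by
  have : bSet n k =
      Finset.range (min (palLen k + 1 - len k .b) (n + 1 - (len k .a + 2 * len k .b))) := by
    ext s
    simp only [bSet, Finset.mem_filter, Finset.mem_range]
    omega
  rw [this, Finset.card_range]

lemma len_a_le_two_mul_len_b {k : ℕ} (hk : 0 < k) : len k .a ≤ 2 * len k .b := by
  obtain ⟨k, rfl⟩ : ∃ l, k = l + 1 := ⟨k - 1, by omega⟩
  have := len_c_le_len_b k
  simp only [len]
  omega

lemma A_eq_sum_of_lt {n m : ℕ} (hm : 0 < m) (h : n < 2 * len m .a) :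
    A n = ∑ k ∈ Finset.range m, (aSet n k).card + ∑ k ∈ Finset.range m, (bSet n k).card := by
  rw [A_eq_sum (show n < max (n + 1) m by omega)]
  have hsub : Finset.range m ⊆ Finset.range (max (n + 1) m) :=
    Finset.range_mono (le_max_right _ _)
  congr 1
  · refine (Finset.sum_subset hsub fun k _ hk => ?_).symm
    rw [Finset.mem_range, not_lt] at hk
    have := len_mono hk .a
    rw [card_aSet]
    omega
  · refine (Finset.sum_subset hsub fun k _ hk => ?_).symm
    rw [Finset.mem_range, not_lt] at hk
    have := len_mono hk .a
    have := len_a_le_two_mul_len_b (hm.trans_le hk)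
    have := palLen_lt k
    rw [card_bSet]
    omega

lemma sum_card_aSet {n i : ℕ} (hn : 2 * len (i + 2) .a ≤ n) :
    ∑ k ∈ Finset.range i, (aSet n k).card = palLen i := by
  induction i with
  | zero => rfl
  | succ i ih =>
    have h := len_mono (show i + 2 ≤ i + 1 + 2 by omega) .a
    rw [Finset.sum_range_succ, ih (by omega), card_aSet, palLen]
    have := palLen_lt i
    have := len_c_le i .a
    simp only [len] at *
    omega

lemma sum_card_bSet {n i : ℕ} (hn : 2 * len i .a ≤ n) :
    2 * ∑ k ∈ Finset.range i, (bSet n k).card + (i + 1) = len i .b := by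
  induction i with
  | zero => rfl
  | succ i ih =>
    have h := len_mono (show i ≤ i + 1 by omega) .a
    have ih' := ih (by omega)
    have hcard : (bSet n i).card = palLen i + 1 - len i .b := by
      rw [card_bSet]
      have := palLen_lt i
      have := len_c_le i .b
      simp only [len] at *
      omega
    have := len_a_le_palLen_succ i
    have := len_c_le_len_b i
    have := two_mul_palLen i
    rw [Finset.sum_range_succ, hcard]
    simp only [len]
    omega

lemma tribAux_eq_len (k : ℕ) :
    tribAux (k + 2) = len k .a ∧ tribAux (k + 1) + tribAux k = len k .b ∧
      tribAux (k + 1) = len k .c := by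
  induction k with
  | zero => decide
  | succ k ih =>
    have h : tribAux (k + 1 + 2) = tribAux (k + 2) + tribAux (k + 1) + tribAux k := rfl
    have h' : tribAux (k + 1 + 1) = tribAux (k + 2) := rfl
    simp only [len]
    omega

lemma t_eq_len {m : ℤ} {k : ℕ} (h : m = k) : t m = len k .a := by
  rw [t, h, ← (tribAux_eq_len k).1]
  rfl

lemma A_closed_form {n j : ℕ} (hn : 2 * len (j + 3) .a ≤ n) (hn' : n < 2 * len (j + 4) .a) :
    2 * A n + (j + 4) = 2 * palLen (j + 1) + len (j + 3) .b +
      2 * ((aSet n (j + 1)).card + (aSet n (j + 2)).card + (aSet n (j + 3)).card +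
        (bSet n (j + 3)).card) := by
  have h₁ := sum_card_aSet (i := j + 1) hn
  have h₂ := sum_card_bSet hn
  rw [A_eq_sum_of_lt (by omega) hn', Finset.sum_range_succ _ (j + 3), Finset.sum_range_succ _ (j + 3),
    Finset.sum_range_succ _ (j + 2), Finset.sum_range_succ _ (j + 1), h₁]
  omega

lemma A_small {n : ℕ} (hn : n < 14) : A n = if n < 8 then 0 else if n < 10 then 1 else 2 := by
  rw [A_eq_sum_of_lt (m := 3) (by omega) hn]
  simp only [card_aSet, card_bSet, Finset.sum_range_succ, Finset.sum_range_zero, palLen, len]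
  interval_cases n <;> rfl

set_option maxHeartbeats 600000 in
/-- The values of `A` on the interval `[2 t_{m-1}, 2 t_m)`, where `m = j + 4`, in terms of
`t_{m-1}`, `t_{m-2}` and `t_{m-3}`. -/
lemma A_piecewise {n j x y z : ℕ} (hx : len (j + 3) .a = x) (hy : len (j + 2) .a = y)
    (hz : len (j + 1) .a = z) (hn : 2 * x ≤ n) (hn' : n < 2 * (x + y + z)) :
    (n + 1 < x + y + 3 * z → 2 * A n + (x + y + 2 * z + (j + 4) + 3) = 2 * n) ∧
    (x + y + 3 * z ≤ n + 1 → n < x + 2 * y + 2 * z →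
      2 * A n + (j + 4) + 5 = x + y + 4 * z) ∧
    (x + 2 * y + 2 * z ≤ n → 2 * n + 3 < 3 * x + 4 * y + 3 * z →
      2 * A n + (x + 3 * y + (j + 4) + 3) = 2 * n) ∧
    (3 * x + 4 * y + 3 * z ≤ 2 * n + 3 → 2 * A n + (j + 4) + 6 = 2 * x + y + 3 * z) := by
  have hlen : len (j + 4) .a = x + y + z := by
    subst hx hy hz
    simp only [len]
    omega
  have hA := A_closed_form (n := n) (j := j) (by omega) (by omega)
  have h₁ := two_mul_palLen j
  have h₂ := len_c_le_len_b j
  have h₃ := len_pos j .c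
  have h₄ := len_a_le_palLen_succ j
  have h₅ := palLen_lt j
  have ha₁ := card_aSet n (j + 1)
  have ha₂ := card_aSet n (j + 2)
  have ha₃ := card_aSet n (j + 3)
  have hb := card_bSet n (j + 3)
  generalize (aSet n (j + 1)).card = A₁ at *
  generalize (aSet n (j + 2)).card = A₂ at *
  generalize (aSet n (j + 3)).card = A₃ at *
  generalize (bSet n (j + 3)).card = B₃ at *
  generalize A n = S at *
  simp only [len, palLen] at *
  generalize len j .a = a at *
  generalize len j .b = b at *
  generalize len j .c = c at *
  generalize palLen j = p at *
  subst hx hy hz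
  replace ha₁ : A₁ = p + 1 - b +
      (min (a + b) (n + 1 - (8 * a + 5 * b + 2 * c)) - (p + 1 - b)) := by
    rw [ha₁, min_eq_left (by clear ha₁ ha₂ ha₃ hb hA; omega),
      show p + a + 1 - (a + b) = p + 1 - b by clear ha₁ ha₂ ha₃ hb hA; omega,
      show 5 * (a + b) + 2 * (a + c) + a = 8 * a + 5 * b + 2 * c by ring]
  replace ha₂ : A₂ = p + 1 - c := by
    rw [ha₂, min_eq_left (by clear ha₁ ha₂ ha₃ hb hA; omega),
      Nat.sub_eq_zero_of_le (n := n + 1) (by clear ha₁ ha₂ ha₃ hb hA; omega), Nat.min_zero]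
    clear ha₁ ha₂ ha₃ hb hA
    omega
  replace ha₃ : A₃ = min (p + 1) (n + 1 - (8 * a + 4 * b + 2 * c)) := by
    rw [ha₃, Nat.sub_eq_zero_of_le (n := n + 1)
        (m := 5 * (a + b + (a + c) + (a + b + a)) + _ + _) (by clear ha₁ ha₂ ha₃ hb hA; omega),
      Nat.min_zero, Nat.zero_sub, Nat.add_zero]
    congr 1 <;> clear ha₁ ha₂ ha₃ hb hA <;> omega
  replace hb : B₃ = min (p + a + 1) (n + 1 - (10 * a + 6 * b + 3 * c)) := by
    rw [hb]
    congr 1 <;> clear ha₁ ha₂ ha₃ hb hA <;> omega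
  clear hlen
  obtain ⟨k, rfl⟩ : ∃ k, n = 8 * a + 4 * b + 2 * c + k := Nat.exists_eq_add_of_le (by omega)
  rw [show 8 * a + 4 * b + 2 * c + k + 1 - (8 * a + 5 * b + 2 * c) = k + 1 - b by omega] at ha₁
  rw [show 8 * a + 4 * b + 2 * c + k + 1 - (8 * a + 4 * b + 2 * c) = k + 1 by omega] at ha₃
  rw [show 8 * a + 4 * b + 2 * c + k + 1 - (10 * a + 6 * b + 3 * c) =
    k + 1 - (2 * a + 2 * b + c) by omega] at hb
  have hA₁ (h : p ≤ k) : A₁ = min (a + b) (k + 1 - b) := by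
    rw [ha₁, Nat.add_sub_cancel' (by rw [le_min_iff]; omega)]
  have hA₃ (h : p ≤ k) : A₃ = p + 1 := by rw [ha₃, min_eq_left (by omega)]
  have hB₃ (h : k + 1 ≤ 2 * a + 2 * b + c) : B₃ = 0 := by
    rw [hb, Nat.sub_eq_zero_of_le h, Nat.min_zero]
  refine ⟨fun h => ?_, fun h h' => ?_, fun h h' => ?_, fun h => ?_⟩
  · rw [hB₃ (by omega)] at hA
    rcases le_total p k with hk | hk
    · rw [hA₁ hk, min_eq_right (by omega), hA₃ hk] at hA
      omega
    · rw [min_eq_right (by omega)] at ha₃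
      rw [Nat.sub_eq_zero_of_le ((min_le_right _ _).trans (by omega))] at ha₁
      omega
  · rw [hB₃ (by omega), hA₁ (by omega), min_eq_left (by omega), hA₃ (by omega)] at hA
    omega
  · rw [min_eq_right (by omega)] at hb
    rw [hA₁ (by omega), min_eq_left (by omega), hA₃ (by omega)] at hA
    omega
  · rw [min_eq_left (by omega)] at hb
    rw [hA₁ (by omega), min_eq_left (by omega), hA₃ (by omega)] at hA
    omega

lemma tribAux_mono : Monotone tribAux :=
  monotone_nat_of_le_succ fun k => by
    rcases k with _ | _ | k
    · decide
    · decide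
    · exact (Nat.le_add_right _ _).trans (Nat.le_add_right _ _)

lemma le_of_lt_two_mul_t {n : ℕ} {m : ℤ} (hn : 14 ≤ n) (h : (n : ℤ) < 2 * (t m : ℤ)) :
    4 ≤ m := by
  by_contra! hm
  have h₁ : t m ≤ tribAux 5 := tribAux_mono (by omega)
  have h₂ : tribAux 5 = 7 := rfl
  omega

end Tribonacci

open Tribonacci in
theorem distinct_squares_count :
    (∀ n : ℕ, 1 ≤ n → n ≤ 7 → A n = 0) ∧
    A 8 = 1 ∧ A 9 = 1 ∧
    (∀ n : ℕ, 10 ≤ n → n ≤ 13 → A n = 2) ∧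
    (∀ n : ℕ, 14 ≤ n → ∀ m : ℤ,
      2 * (t (m - 1) : ℤ) ≤ (n : ℤ) → (n : ℤ) < 2 * (t m : ℤ) →
      4 ≤ m ∧
      ((n : ℚ) < (t m : ℚ) + 2 * (t (m - 3) : ℚ) - 1 →
        (A n : ℚ) = (n : ℚ) - ((t m : ℚ) + (t (m - 3) : ℚ) + (m : ℚ) + 3) / 2) ∧
      ((t m : ℚ) + 2 * (t (m - 3) : ℚ) - 1 ≤ (n : ℚ) →
          (n : ℚ) < 2 * (t m : ℚ) - (t (m - 1) : ℚ) →
        (A n : ℚ) = ((t (m - 1) : ℚ) + (t (m - 2) : ℚ) + 4 * (t (m - 3) : ℚ)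
          - (m : ℚ) - 5) / 2) ∧
      (2 * (t m : ℚ) - (t (m - 1) : ℚ) ≤ (n : ℚ) →
          (n : ℚ) < (3 * (t m : ℚ) + (t (m - 2) : ℚ) - 3) / 2 →
        (A n : ℚ) = (n : ℚ) - ((t (m - 1) : ℚ) + 3 * (t (m - 2) : ℚ) + (m : ℚ) + 3) / 2) ∧
      ((3 * (t m : ℚ) + (t (m - 2) : ℚ) - 3) / 2 ≤ (n : ℚ) →
        (A n : ℚ) = (2 * (t (m - 1) : ℚ) + (t (m - 2) : ℚ) + 3 * (t (m - 3) : ℚ)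
          - (m : ℚ) - 6) / 2)) := by
  refine ⟨fun n _ hn => ?_, ?_, ?_, fun n h₁ h₂ => ?_, fun n hn m hm hm' => ?_⟩
  · rw [A_small (by omega), if_pos (by omega)]
  · rw [A_small (by omega)]
    rfl
  · rw [A_small (by omega)]
    rfl
  · rw [A_small (by omega), if_neg (by omega), if_neg (by omega)]
  · have h4 := le_of_lt_two_mul_t hn hm'
    refine ⟨h4, ?_⟩
    obtain ⟨j, rfl⟩ : ∃ j : ℕ, m = j + 4 := ⟨(m - 4).toNat, by omega⟩
    have ht : t ((j : ℤ) + 4) = t ((j : ℤ) + 4 - 1) + t ((j : ℤ) + 4 - 2) + t ((j : ℤ) + 4 - 3) := by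
      rw [t_eq_len (k := j + 4) (by push_cast; ring), t_eq_len (k := j + 3) (by push_cast; ring),
        t_eq_len (k := j + 2) (by push_cast; ring), t_eq_len (k := j + 1) (by push_cast; ring)]
      simp only [len]
      omega
    have hx := t_eq_len (m := (j : ℤ) + 4 - 1) (k := j + 3) (by push_cast; ring)
    have hy := t_eq_len (m := (j : ℤ) + 4 - 2) (k := j + 2) (by push_cast; ring)
    have hz := t_eq_len (m := (j : ℤ) + 4 - 3) (k := j + 1) (by push_cast; ring)
    rw [ht] at hm' ⊢
    generalize t ((j : ℤ) + 4 - 1) = x at *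
    generalize t ((j : ℤ) + 4 - 2) = y at *
    generalize t ((j : ℤ) + 4 - 3) = z at *
    obtain ⟨h₁, h₂, h₃, h₄⟩ :=
      A_piecewise (n := n) hx.symm hy.symm hz.symm (by omega) (by omega)
    push_cast
    refine ⟨fun h => ?_, fun h h' => ?_, fun h h' => ?_, fun h => ?_⟩
    · have hN : n + 1 < x + y + 3 * z := by
        have : (n : ℚ) + 1 < x + y + 3 * z := by linarith
        exact_mod_cast this
      have := congrArg (Nat.cast : ℕ → ℚ) (h₁ hN)
      push_cast at this
      linarith
    · have hN : x + y + 3 * z ≤ n + 1 := by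
        have : (x : ℚ) + y + 3 * z ≤ n + 1 := by linarith
        exact_mod_cast this
      have hN' : n < x + 2 * y + 2 * z := by
        have : (n : ℚ) < x + 2 * y + 2 * z := by linarith
        exact_mod_cast this
      have := congrArg (Nat.cast : ℕ → ℚ) (h₂ hN hN')
      push_cast at this
      linarith
    · have hN : x + 2 * y + 2 * z ≤ n := by
        have : (x : ℚ) + 2 * y + 2 * z ≤ n := by linarith
        exact_mod_cast this
      have hN' : 2 * n + 3 < 3 * x + 4 * y + 3 * z := by
        have : 2 * (n : ℚ) + 3 < 3 * x + 4 * y + 3 * z := by linarith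
        exact_mod_cast this
      have := congrArg (Nat.cast : ℕ → ℚ) (h₃ hN hN')
      push_cast at this
      linarith
    · have hN : 3 * x + 4 * y + 3 * z ≤ 2 * n + 3 := by
        have : 3 * (x : ℚ) + 4 * y + 3 * z ≤ 2 * n + 3 := by linarith
        exact_mod_cast this
      have := congrArg (Nat.cast : ℕ → ℚ) (h₄ hN)
      push_cast at this
      linarith
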